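/- Let q be a prime, let λ : ℕ≥1 → ℂ satisfy the normalized Hecke relations with constants C > 0 and A ≥ 0 such that |λ(n)| ≤ C·n^A for all n ≥ 1, and let ν ∈ ℂ. Then for every s ∈ ℂ with Re s > 1 + A + max(0, Re ν) one has ∑_{n≥1, q ∤ n} λ(n) σ_ν(n) n^{−s} = (L(s)·L(s−ν)/ζ(2s−ν)) · (1 − λ(q) q^{−s} + q^{−2s})·(1 − λ(q) q^{ν−s} + q^{2ν−2s})/(1 − q^{ν−2s}), where L(w) = ∑_{n≥1} λ(n) n^{−w} and ζ is the Riemann zeta function. -/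

import Mathlib

/-- The complex divisor sum `σ_ν(n) = ∑_{d ∣ n} d^ν`. -/
noncomputable def csigma (ν : ℂ) (n : ℕ) : ℂ := ∑ d ∈ n.divisors, (d : ℂ) ^ ν

/-- The Dirichlet series `L(w) = ∑_{n ≥ 1} l n * n ^ (-w)` attached to `l`. -/
noncomputable def Lfun (l : ℕ → ℂ) (w : ℂ) : ℂ :=
  ∑' n : ℕ, if n = 0 then 0 else l n * (n : ℂ) ^ (-w)

/-- The Hecke relation `a (i + 1) * a (j + 1) = a (i + j + 2) + a i * a j` for a sequence
satisfying the Chebyshev recurrence. -/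
theorem chebyshev_rec_mul {a : ℕ → ℂ} (h0 : a 0 = 1)
    (hrec : ∀ k, a (k + 2) = a 1 * a (k + 1) - a k) (i j : ℕ) :
    a (i + 1) * a (j + 1) = a (i + j + 2) + a i * a j := by
  induction j using Nat.twoStepInduction with
  | zero => simp [hrec i, h0, mul_comm]
  | one =>
    have h2 := hrec i
    have h3 : a (i + 1 + 2) = a 1 * a (i + 2) - a (i + 1) := hrec (i + 1)
    have h4 : a 2 = a 1 * a 1 - a 0 := hrec 0
    simp only [show i + 1 + 2 = i + 3 from rfl, Nat.reduceAdd] at *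
    rw [h3, h2, h4, h0]
    ring
  | more j ih1 ih2 =>
    have h1 : a (i + (j + 2) + 2) = a 1 * a (i + (j + 1) + 2) - a (i + j + 2) :=
      hrec (i + j + 2)
    have h2 : a (j + 2 + 1) = a 1 * a (j + 1 + 1) - a (j + 1) := hrec (j + 1)
    rw [h1, h2]
    linear_combination a 1 * ih2 - ih1 - a i * hrec j

/-- The generating series of a sequence satisfying the Chebyshev recurrence. -/
theorem tsum_chebyshev_rec_mul_eq_one {a : ℕ → ℂ} (h0 : a 0 = 1)
    (hrec : ∀ k, a (k + 2) = a 1 * a (k + 1) - a k) {x : ℂ}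
    (hx : Summable fun k ↦ a k * x ^ k) :
    (∑' k, a k * x ^ k) * (1 - a 1 * x + x ^ 2) = 1 := by
  have hx1 : Summable fun k ↦ a (k + 1) * x ^ (k + 1) := (summable_nat_add_iff 1).2 hx
  have e1 := hx.tsum_eq_zero_add
  have e2 : ∑' k, a (k + 1) * x ^ (k + 1) =
      a 1 * x + ∑' k, a (k + 2) * x ^ (k + 2) := by
    simpa using hx1.tsum_eq_zero_add
  have e3 : ∑' k, a (k + 2) * x ^ (k + 2) =
      a 1 * x * (∑' k, a (k + 1) * x ^ (k + 1)) - x ^ 2 * ∑' k, a k * x ^ k := by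
    rw [← tsum_mul_left, ← tsum_mul_left,
      ← (hx1.mul_left _).tsum_sub (hx.mul_left _)]
    refine tsum_congr fun k ↦ ?_
    rw [hrec]
    ring
  simp only [h0, pow_zero, mul_one] at e1
  linear_combination (1 - a 1 * x) * e1 + e2 + e3

/-- The local Rankin–Selberg type identity: twisting the coefficients `a k` by the complete
homogeneous sums in `x` and `y`. -/
theorem tsum_chebyshev_rec_mul_antidiagonal {a : ℕ → ℂ} (h0 : a 0 = 1)
    (hrec : ∀ k, a (k + 2) = a 1 * a (k + 1) - a k) {x y : ℂ}
    (hx : Summable fun k ↦ ‖a k * x ^ k‖) (hy : Summable fun k ↦ ‖a k * y ^ k‖) :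
    ∑' k, a k * ∑ p ∈ Finset.HasAntidiagonal.antidiagonal k, x ^ p.1 * y ^ p.2 =
      (1 - x * y) * ((∑' k, a k * x ^ k) * ∑' k, a k * y ^ k) := by
  set b : ℕ × ℕ → ℂ := fun p ↦ a p.1 * x ^ p.1 * (a p.2 * y ^ p.2) with hb
  set c : ℕ × ℕ → ℂ := fun p ↦ a (p.1 + p.2) * (x ^ p.1 * y ^ p.2) with hc
  have hbs : Summable b := summable_mul_of_summable_norm (R := ℂ)
    (f := fun k ↦ a k * x ^ k) (g := fun k ↦ a k * y ^ k) hx hy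
  let φ : ℕ × ℕ → ℕ × ℕ := fun p ↦ (p.1 + 1, p.2 + 1)
  have hφ : Function.Injective φ := by
    rintro ⟨i, j⟩ ⟨k, l⟩ h
    simpa [φ] using h
  let d : ℕ × ℕ → ℂ := fun p ↦ b p - c p
  have hd : HasSum d (x * y * ∑' p, b p) := by
    refine (hφ.hasSum_iff ?_).1 ((hbs.hasSum.mul_left (x * y)).congr_fun ?_)
    · rintro ⟨i, j⟩ hij
      rcases i with - | i
      · simp [d, hb, hc, h0]
      · rcases j with - | j
        · simp [d, hb, hc, h0]
        · exact absurd ⟨(i, j), rfl⟩ hij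
    · rintro ⟨i, j⟩
      have := chebyshev_rec_mul h0 hrec i j
      simp only [d, φ, hb, hc, Function.comp_apply]
      rw [show i + 1 + (j + 1) = i + j + 2 by ring]
      linear_combination x ^ (i + 1) * y ^ (j + 1) * this
  have hcs : HasSum c ((1 - x * y) * ∑' p, b p) := by
    convert! hbs.hasSum.sub hd using 1
    · ext p
      simp [d]
    · ring
  rw [tsum_mul_tsum_of_summable_norm hx hy, ← hcs.tsum_eq,
    ← Finset.HasAntidiagonal.sigmaAntidiagonalEquivProd.tsum_eq c,
    Summable.tsum_sigma'
      (f := fun r ↦ c (Finset.HasAntidiagonal.sigmaAntidiagonalEquivProd r))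
      (fun n ↦ (hasSum_fintype _).summable)
      (Finset.HasAntidiagonal.sigmaAntidiagonalEquivProd.summable_iff.2 hcs.summable)]
  refine tsum_congr fun n ↦ ?_
  rw [tsum_fintype, Finset.mul_sum, ← Finset.sum_coe_sort]
  refine Finset.sum_congr rfl fun p _ ↦ ?_
  have hp := Finset.HasAntidiagonal.mem_antidiagonal.1 p.2
  simp [hc, hp]

theorem csigma_one (ν : ℂ) : csigma ν 1 = 1 := by simp [csigma]

theorem csigma_mul_of_coprime (ν : ℂ) {m n : ℕ} (h : m.Coprime n) :
    csigma ν (m * n) = csigma ν m * csigma ν n := by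
  simp only [csigma]
  rw [h.divisors_mul, Finset.sum_map, Finset.sum_mul_sum, ← Finset.sum_product',
    ← Finset.sum_attach (m.divisors ×ˢ n.divisors)]
  refine Finset.sum_congr rfl fun p _ ↦ ?_
  simp [Complex.natCast_mul_natCast_cpow]

theorem natCast_pow_cpow (p k : ℕ) (w : ℂ) :
    ((p ^ k : ℕ) : ℂ) ^ w = ((p : ℂ) ^ w) ^ k := by
  rw [Nat.cast_pow, ← Complex.natCast_cpow_natCast_mul, ← Complex.cpow_nat_mul]

/-- At prime powers, `σ_ν(p ^ k) * (p ^ (-s)) ^ k` is a complete homogeneous sum. -/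
theorem csigma_prime_pow_mul_cpow (ν s : ℂ) {p : ℕ} (hp : p.Prime) (k : ℕ) :
    csigma ν (p ^ k) * ((p : ℂ) ^ (-s)) ^ k =
      ∑ r ∈ Finset.HasAntidiagonal.antidiagonal k,
        ((p : ℂ) ^ (-s)) ^ r.1 * ((p : ℂ) ^ (ν - s)) ^ r.2 := by
  have hp0 : (p : ℂ) ≠ 0 := by exact_mod_cast hp.ne_zero
  rw [csigma, Nat.sum_divisors_prime_pow hp, Finset.sum_mul,
    ← Finset.Nat.sum_antidiagonal_swap,
    Finset.Nat.sum_antidiagonal_eq_sum_range_succ_mk]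
  refine Finset.sum_congr rfl fun j hj ↦ ?_
  have hjk : k - j + j = k := Nat.sub_add_cancel (Finset.mem_range_succ_iff.1 hj)
  simp only [Prod.fst_swap, Prod.snd_swap]
  rw [natCast_pow_cpow, sub_eq_add_neg, Complex.cpow_add _ _ hp0, mul_pow]
  nth_rewrite 1 [← hjk]
  ring

/-- The Euler product of the Dirichlet series of a multiplicative function. -/
theorem hasProd_tsum_prime_pow {g : ℕ → ℂ} (h1 : g 1 = 1)
    (hmul : ∀ m n : ℕ, 1 ≤ m → 1 ≤ n → Nat.Coprime m n → g (m * n) = g m * g n) {w : ℂ}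
    (hsum : Summable fun n : ℕ ↦ ‖if n = 0 then 0 else g n * (n : ℂ) ^ (-w)‖) :
    HasProd (fun p : Nat.Primes ↦ ∑' k : ℕ, g ((p : ℕ) ^ k) * (((p : ℕ) : ℂ) ^ (-w)) ^ k)
      (∑' n : ℕ, if n = 0 then 0 else g n * (n : ℂ) ^ (-w)) := by
  have key := EulerProduct.eulerProduct_hasProd
    (f := fun n : ℕ ↦ if n = 0 then 0 else g n * (n : ℂ) ^ (-w))
    (by simp [h1]) ?_ hsum (by simp)
  · convert! key using 2 with p
    refine tsum_congr fun k ↦ ?_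
    rw [if_neg (pow_ne_zero k p.2.ne_zero), natCast_pow_cpow]
  · intro m n hmn
    rcases Nat.eq_zero_or_pos m with rfl | hm
    · simp
    rcases Nat.eq_zero_or_pos n with rfl | hn
    · simp
    simp only [mul_eq_zero, hm.ne', hn.ne', or_self, if_false]
    rw [hmul m n hm hn hmn, Nat.cast_mul, Complex.natCast_mul_natCast_cpow]
    ring

theorem summable_norm_prime_pow_of_summable_norm {g : ℕ → ℂ} {w : ℂ}
    (hsum : Summable fun n : ℕ ↦ ‖if n = 0 then 0 else g n * (n : ℂ) ^ (-w)‖)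
    {p : ℕ} (hp : p.Prime) :
    Summable fun k : ℕ ↦ ‖g (p ^ k) * ((p : ℂ) ^ (-w)) ^ k‖ := by
  refine (hsum.comp_injective (Nat.pow_right_injective hp.two_le)).congr fun k ↦ ?_
  rw [Function.comp_apply, if_neg (pow_ne_zero k hp.ne_zero), natCast_pow_cpow]

theorem ite_mul_cpow_neg_eq_term (g : ℕ → ℂ) (w : ℂ) (n : ℕ) :
    (if n = 0 then 0 else g n * (n : ℂ) ^ (-w)) = LSeries.term g w n := by
  rw [LSeries.term_def, Complex.cpow_neg, div_eq_mul_inv]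

theorem summable_norm_of_le_rpow {g : ℕ → ℂ} {C A : ℝ}
    (hbd : ∀ n : ℕ, 1 ≤ n → ‖g n‖ ≤ C * (n : ℝ) ^ A) {w : ℂ} (hw : 1 + A < w.re) :
    Summable fun n : ℕ ↦ ‖if n = 0 then 0 else g n * (n : ℂ) ^ (-w)‖ := by
  simp only [ite_mul_cpow_neg_eq_term]
  exact (LSeriesSummable_of_le_const_mul_rpow hw
    ⟨C, fun n hn ↦ by simpa using hbd n (Nat.pos_of_ne_zero hn)⟩).norm

theorem norm_csigma_le (ν : ℂ) (n : ℕ) : ‖csigma ν n‖ ≤ ‖csigma (ν.re : ℂ) n‖ := by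
  have h : csigma (ν.re : ℂ) n = ((∑ d ∈ n.divisors, (d : ℝ) ^ ν.re : ℝ) : ℂ) := by
    simp [csigma, Complex.ofReal_cpow]
  rw [h, Complex.norm_of_nonneg (Finset.sum_nonneg fun d _ ↦ by positivity)]
  refine (norm_sum_le _ _).trans (Finset.sum_le_sum fun d hd ↦ ?_)
  rw [Complex.norm_natCast_cpow_of_pos (Nat.pos_of_mem_divisors hd)]

/-- Absolute convergence of the Dirichlet series of `l n * σ_ν(n)`. -/
theorem summable_norm_mul_csigma {l : ℕ → ℂ} {C A : ℝ}
    (hbd : ∀ n : ℕ, 1 ≤ n → ‖l n‖ ≤ C * (n : ℝ) ^ A) {ν s : ℂ}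
    (hs : 1 + A + max 0 ν.re < s.re) :
    Summable fun n : ℕ ↦ ‖if n = 0 then 0 else l n * csigma ν n * (n : ℂ) ^ (-s)‖ := by
  have hs0 : 1 + A < s.re := by linarith [le_max_left 0 ν.re]
  have hsν : 1 + A + ν.re < s.re := by linarith [le_max_right 0 ν.re]
  have hpow : LSeriesSummable (fun d : ℕ ↦ (d : ℂ) ^ (ν.re : ℂ)) (s - A) := by
    refine LSeriesSummable_of_le_const_mul_rpow (x := ν.re + 1) (by simp; linarith)
      ⟨1, fun n hn ↦ ?_⟩
    simp [Complex.norm_natCast_cpow_of_pos (Nat.pos_of_ne_zero hn)]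
  have hone : LSeriesSummable (fun _ : ℕ ↦ (1 : ℂ)) (s - A) :=
    LSeriesSummable_of_le_const_mul_rpow (x := 1) (by simp; linarith) ⟨1, fun n hn ↦ by simp⟩
  have hconv := (hpow.convolution hone).norm.mul_left C
  refine hconv.of_nonneg_of_le (fun n ↦ norm_nonneg _) fun n ↦ ?_
  rcases Nat.eq_zero_or_pos n with rfl | hn
  · simp
  have hn' : (0 : ℝ) < n := by exact_mod_cast hn
  have hc : LSeries.convolution (fun d : ℕ ↦ (d : ℂ) ^ (ν.re : ℂ)) (fun _ : ℕ ↦ (1 : ℂ)) n =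
      csigma (ν.re : ℂ) n := by
    rw [LSeries.convolution_def, csigma]
    simp only [mul_one]
    exact Nat.sum_divisorsAntidiagonal fun d _ ↦ (d : ℂ) ^ (ν.re : ℂ)
  rw [if_neg hn.ne', ← ite_mul_cpow_neg_eq_term, if_neg hn.ne', hc, norm_mul, norm_mul, norm_mul,
    Complex.norm_natCast_cpow_of_pos hn, Complex.norm_natCast_cpow_of_pos hn,
    show (-(s - A)).re = A + (-s).re by simp; ring, Real.rpow_add hn']
  calc ‖l n‖ * ‖csigma ν n‖ * (n : ℝ) ^ (-s).re
      ≤ C * (n : ℝ) ^ A * ‖csigma (ν.re : ℂ) n‖ * (n : ℝ) ^ (-s).re := by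
        gcongr
        · exact (norm_nonneg _).trans (hbd n hn)
        · exact hbd n hn
        · exact norm_csigma_le ν n
    _ = _ := by ring

/-- Removing the Euler factor at the prime `q`: if `l` satisfies the normalized Hecke
relations with polynomial bound, then for `Re s > 1 + A + max 0 (Re ν)` one has
`∑_{n ≥ 1, q ∤ n} l n * σ_ν n * n^(-s)
  = (L(s) L(s - ν) / ζ(2s - ν)) * (1 - l q q^(-s) + q^(-2s))(1 - l q q^(ν - s) + q^(2ν - 2s))
      / (1 - q^(ν - 2s))`. -/
theorem hecke_divisor_dirichlet_series_coprime_to_q (q : ℕ) (hq : q.Prime)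
    (l : ℕ → ℂ) (C A : ℝ) (hC : 0 < C) (hA : 0 ≤ A)
    (h1 : l 1 = 1)
    (hmul : ∀ m n : ℕ, 1 ≤ m → 1 ≤ n → Nat.Coprime m n → l (m * n) = l m * l n)
    (hrec : ∀ p : ℕ, p.Prime → ∀ k : ℕ, 1 ≤ k →
      l (p ^ (k + 1)) = l p * l (p ^ k) - l (p ^ (k - 1)))
    (hbd : ∀ n : ℕ, 1 ≤ n → ‖l n‖ ≤ C * (n : ℝ) ^ A)
    (ν : ℂ) (s : ℂ) (hs : 1 + A + max 0 ν.re < s.re) :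
    (∑' n : ℕ, if n ≠ 0 ∧ ¬ q ∣ n then l n * csigma ν n * (n : ℂ) ^ (-s) else 0) =
      (Lfun l s * Lfun l (s - ν) / riemannZeta (2 * s - ν)) *
        ((1 - l q * (q : ℂ) ^ (-s) + (q : ℂ) ^ (-(2 * s))) *
          (1 - l q * (q : ℂ) ^ (ν - s) + (q : ℂ) ^ (2 * ν - 2 * s)) /
            (1 - (q : ℂ) ^ (ν - 2 * s))) := by
  have hs0 : 1 + A < s.re := by linarith [le_max_left 0 ν.re]
  have hsν : 1 + A < (s - ν).re := by
    rw [Complex.sub_re]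
    linarith [le_max_right 0 ν.re]
  have hz : 1 < (2 * s - ν).re := by
    simp only [Complex.sub_re, Complex.mul_re, Complex.re_ofNat, Complex.im_ofNat, zero_mul,
      sub_zero] at hsν ⊢
    linarith
  let g : ℕ → ℂ := fun n ↦ if q ∣ n then 0 else l n * csigma ν n
  have hgsum : Summable fun n : ℕ ↦ ‖if n = 0 then 0 else g n * (n : ℂ) ^ (-s)‖ := by
    refine (summable_norm_mul_csigma hbd hs).of_nonneg_of_le (fun n ↦ norm_nonneg _) fun n ↦ ?_
    by_cases hn : n = 0
    · simp [hn]
    · by_cases hqn : q ∣ n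
      · simp only [hn, g, hqn, if_true, if_false, zero_mul, norm_zero, norm_nonneg]
      · simp [hn, g, hqn]
  have hgmul : ∀ m n : ℕ, 1 ≤ m → 1 ≤ n → Nat.Coprime m n → g (m * n) = g m * g n := by
    intro m n hm hn hmn
    by_cases hqm : q ∣ m
    · simp [g, hqm, hqm.mul_right n]
    by_cases hqn : q ∣ n
    · simp [g, hqn, hqn.mul_left m]
    simp only [g, hq.dvd_mul, hqm, hqn, or_self, if_false]
    rw [hmul m n hm hn hmn, csigma_mul_of_coprime ν hmn]
    ring
  have hlsum := summable_norm_of_le_rpow hbd hs0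
  have hlνsum := summable_norm_of_le_rpow hbd hsν
  have hprodg := hasProd_tsum_prime_pow (by simp [g, hq.one_lt.ne', h1, csigma_one]) hgmul hgsum
  have hprodL := hasProd_tsum_prime_pow h1 hmul hlsum
  have hprodLν := hasProd_tsum_prime_pow h1 hmul hlνsum
  have hprodζ := riemannZeta_eulerProduct_hasProd hz
  have hcheb (p : ℕ) (hp : p.Prime) (k : ℕ) :
      l (p ^ (k + 2)) = l (p ^ 1) * l (p ^ (k + 1)) - l (p ^ k) := by
    simpa using hrec p hp (k + 1) (by omega)
  have hxy (p : ℕ) (hp : p.Prime) :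
      (p : ℂ) ^ (-s) * (p : ℂ) ^ (-(s - ν)) = (p : ℂ) ^ (-(2 * s - ν)) := by
    rw [← Complex.cpow_add _ _ (by exact_mod_cast hp.ne_zero)]
    ring_nf
  have hne (p : ℕ) (hp : p.Prime) : 1 - (p : ℂ) ^ (-(2 * s - ν)) ≠ 0 := by
    intro h
    have hlt : ‖(p : ℂ) ^ (-(2 * s - ν))‖ < 1 := by
      rw [Complex.norm_natCast_cpow_of_pos hp.pos]
      exact Real.rpow_lt_one_of_one_lt_of_neg (by exact_mod_cast hp.one_lt)
        (by rw [Complex.neg_re]; linarith)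
    rw [← sub_eq_zero.1 h] at hlt
    simp at hlt
  set E : ℂ → ℕ → ℂ := fun w p ↦ ∑' k : ℕ, l (p ^ k) * ((p : ℂ) ^ (-w)) ^ k with hE
  have hlocal (p : ℕ) (hp : p.Prime) (hpq : p ≠ q) :
      ∑' k : ℕ, g (p ^ k) * ((p : ℂ) ^ (-s)) ^ k =
        (1 - (p : ℂ) ^ (-(2 * s - ν))) * (E s p * E (s - ν) p) := by
    rw [← hxy p hp, hE, ← tsum_chebyshev_rec_mul_antidiagonal (by simpa using h1) (hcheb p hp)
      (summable_norm_prime_pow_of_summable_norm hlsum hp)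
      (summable_norm_prime_pow_of_summable_norm hlνsum hp)]
    refine tsum_congr fun k ↦ ?_
    have hqk : ¬ q ∣ p ^ k := fun h ↦
      hpq ((Nat.prime_dvd_prime_iff_eq hq hp).1 (hq.dvd_of_dvd_pow h)).symm
    rw [neg_sub, ← csigma_prime_pow_mul_cpow ν s hp k]
    simp only [g, hqk, if_false, mul_assoc]
  have hlocalq : ∑' k : ℕ, g (q ^ k) * ((q : ℂ) ^ (-s)) ^ k = 1 := by
    rw [tsum_eq_single 0 fun k hk ↦ by simp [g, dvd_pow_self q hk]]
    simp [g, hq.one_lt.ne', h1, csigma_one]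
  set c : ℂ := (1 - (q : ℂ) ^ (-(2 * s - ν))) * (E s q * E (s - ν) q) with hc
  have hprod := (hprodg.mul hprodζ).mul (hasProd_ite_eq (⟨q, hq⟩ : Nat.Primes) c)
  have heq := (hprod.congr_fun ?_).unique (hprodL.mul hprodLν)
  swap
  · rintro ⟨p, hp⟩
    change E s p * E (s - ν) p =
      (∑' k : ℕ, g (p ^ k) * ((p : ℂ) ^ (-s)) ^ k) * (1 - (p : ℂ) ^ (-(2 * s - ν)))⁻¹ * _
    by_cases hpq : p = q
    · subst hpq
      rw [if_pos rfl, hlocalq, hc, one_mul, inv_mul_cancel_left₀ (hne p hp)]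
    · rw [if_neg fun h ↦ hpq (congrArg Subtype.val h), hlocal p hp hpq, mul_one,
        mul_comm _ (_)⁻¹, inv_mul_cancel_left₀ (hne p hp)]
  have hlhs : (∑' n : ℕ, if n ≠ 0 ∧ ¬ q ∣ n then l n * csigma ν n * (n : ℂ) ^ (-s) else 0) =
      ∑' n : ℕ, if n = 0 then 0 else g n * (n : ℂ) ^ (-s) := by
    refine tsum_congr fun n ↦ ?_
    by_cases hn : n = 0 <;> by_cases hqn : q ∣ n <;> simp [g, hn, hqn]
  have hEs := tsum_chebyshev_rec_mul_eq_one (by simpa using h1) (hcheb q hq)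
    (summable_norm_prime_pow_of_summable_norm hlsum hq).of_norm
  have hEν := tsum_chebyshev_rec_mul_eq_one (by simpa using h1) (hcheb q hq)
    (summable_norm_prime_pow_of_summable_norm hlνsum hq).of_norm
  have hsq (w : ℂ) : ((q : ℂ) ^ w) ^ 2 = (q : ℂ) ^ (2 * w) := by
    rw [← Complex.cpow_nat_mul, Nat.cast_ofNat]
  change E s q * _ = 1 at hEs
  change E (s - ν) q * _ = 1 at hEν
  rw [pow_one, hsq, mul_neg] at hEs
  rw [pow_one, hsq, neg_sub, show 2 * (ν - s) = 2 * ν - 2 * s by ring] at hEν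
  have hζ : riemannZeta (2 * s - ν) ≠ 0 := riemannZeta_ne_zero_of_one_lt_re hz
  have hneq := hne q hq
  rw [hlhs, Lfun, Lfun, ← heq, hc]
  rw [neg_sub] at hneq ⊢
  rw [div_mul_div_comm, eq_div_iff (mul_ne_zero hζ hneq)]
  generalize (∑' n : ℕ, if n = 0 then 0 else g n * (n : ℂ) ^ (-s)) = F
  linear_combination -F * riemannZeta (2 * s - ν) * (1 - (q : ℂ) ^ (ν - 2 * s)) *
    (E (s - ν) q * (1 - l q * (q : ℂ) ^ (ν - s) + (q : ℂ) ^ (2 * ν - 2 * s)) * hEs + hEν)
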